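/- Let p be a finitely supported probability distribution with entropy H > 0 and varentropy V > 0, and for m ∈ ℕ and L ∈ ℕ let S(m, L) = sum of the 2^L largest probabilities among { p^{⊗m}(x) }. Then for L_n = ⌊Hn + b√n⌋ and m_n = n + ⌊b'√n⌋, lim_{n→∞} S(m_n, L_n) = G( (b − H b') / √V ), where G is the standard normal CDF. -/

import Mathlib

open MeasureTheory Real Set Filter Finset

/-- The standard normal cumulative distribution function. -/
noncomputable def stdGaussianCDF (x : ℝ) : ℝ :=
  ∫ t in Set.Iic x, (1 / Real.sqrt (2 * Real.pi)) * Real.exp (-t ^ 2 / 2)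

/-- `sumLargest p m L` is the sum of the `2^L` largest probabilities of the product
distribution `p^{⊗m}`, i.e. the maximum of `p^{⊗m}(A)` over sets `A` with `|A| ≤ 2^L`. -/
noncomputable def sumLargest {α : Type*} [Fintype α] (p : α → ℝ) (m L : ℕ) : ℝ :=
  sSup {y : ℝ | ∃ A : Finset (Fin m → α),
    A.card ≤ 2 ^ L ∧ y = ∑ x ∈ A, ∏ i, p (x i)}

open ProbabilityTheory Topology in
lemma stdGaussianCDF_eq (x : ℝ) : stdGaussianCDF x = (gaussianReal 0 1).real (Set.Iic x) := by
  rw [measureReal_def, gaussianReal_apply_eq_integral 0 one_ne_zero, ENNReal.toReal_ofReal]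
  · simp [stdGaussianCDF, gaussianPDFReal]
  · exact integral_nonneg fun _ => gaussianPDFReal_nonneg _ _ _

open ProbabilityTheory Topology in
lemma stdGaussianCDF_cont : Continuous stdGaussianCDF := by
  have hint : Integrable (fun t : ℝ => (1 / Real.sqrt (2 * Real.pi)) * Real.exp (-t ^ 2 / 2)) := by
    have := integrable_gaussianPDFReal 0 1
    simpa [gaussianPDFReal_def] using this
  have h : ∀ x, stdGaussianCDF x = stdGaussianCDF 0 +
      ∫ t in (0:ℝ)..x, (1 / Real.sqrt (2 * Real.pi)) * Real.exp (-t ^ 2 / 2) := by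
    intro x
    rw [← intervalIntegral.integral_Iic_sub_Iic hint.integrableOn hint.integrableOn]
    simp [stdGaussianCDF]
  rw [funext h]
  exact continuous_const.add (intervalIntegral.continuous_primitive (fun a b => hint.intervalIntegrable) 0)

/-- Probability that the information content of a length `m` word is at most `s`. -/
noncomputable def infoCDF {α : Type*} [Fintype α] (p : α → ℝ) (m : ℕ) (s : ℝ) : ℝ :=
  ∑ x : Fin m → α with ∑ i, -(Real.logb 2 (p (x i))) ≤ s, ∏ i, p (x i)

lemma infoCDF_mono {α : Type*} [Fintype α] (p : α → ℝ) (hp : ∀ a, 0 ≤ p a) (m : ℕ) :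
    Monotone (infoCDF p m) := by
  intro s t hst
  unfold infoCDF
  apply Finset.sum_le_sum_of_subset_of_nonneg
  · intro x
    simp only [Finset.mem_filter, Finset.mem_univ, true_and]
    exact fun h => h.trans hst
  · intro x _ _
    exact Finset.prod_nonneg fun i _ => hp _

lemma prod_sum_one {α : Type*} [Fintype α] (p : α → ℝ) (hsum : ∑ a, p a = 1) (m : ℕ) :
    ∑ x : Fin m → α, ∏ i, p (x i) = 1 := by
  classical
  have := Finset.prod_univ_sum (fun _ : Fin m => (Finset.univ : Finset α)) (fun _ a => p a)
  simp only [hsum, Finset.prod_const_one, Fintype.piFinset_univ] at this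
  exact this.symm

lemma prod_eq_rpow {α : Type*} (p : α → ℝ) (hp : ∀ a, 0 ≤ p a) {m : ℕ}
    (x : Fin m → α) (hx : ∏ i, p (x i) ≠ 0) :
    ∏ i, p (x i) = (2 : ℝ) ^ (-∑ i, -(Real.logb 2 (p (x i)))) := by
  rw [Finset.sum_neg_distrib, neg_neg, Real.rpow_sum_of_pos (by norm_num)]
  refine Finset.prod_congr rfl fun i hi => ?_
  rw [Real.rpow_logb (by norm_num) (by norm_num)]
  exact lt_of_le_of_ne (hp _) (Ne.symm (Finset.prod_ne_zero_iff.1 hx i hi))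

lemma sumLargest_bdd {α : Type*} [Fintype α] (p : α → ℝ) (hp : ∀ a, 0 ≤ p a)
    (hsum : ∑ a, p a = 1) (m L : ℕ) :
    BddAbove {y : ℝ | ∃ A : Finset (Fin m → α),
    A.card ≤ 2 ^ L ∧ y = ∑ x ∈ A, ∏ i, p (x i)} := by
  refine ⟨1, ?_⟩
  rintro y ⟨A, -, rfl⟩
  rw [← prod_sum_one p hsum m]
  exact Finset.sum_le_sum_of_subset_of_nonneg (Finset.subset_univ _)
    fun x _ _ => Finset.prod_nonneg fun i _ => hp _

lemma le_sumLargest {α : Type*} [Fintype α] (p : α → ℝ) (hp : ∀ a, 0 ≤ p a)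
    (hsum : ∑ a, p a = 1) (m L : ℕ) : infoCDF p m L ≤ sumLargest p m L := by
  classical
  set B : Finset (Fin m → α) := {x | ∑ i, -(Real.logb 2 (p (x i))) ≤ L} with hB
  set B' := B.filter (fun x => ∏ i, p (x i) ≠ 0) with hB'
  have h1 : infoCDF p m L = ∑ x ∈ B', ∏ i, p (x i) := (Finset.sum_filter_ne_zero B).symm
  rw [h1]
  refine le_csSup (sumLargest_bdd p hp hsum m L) ⟨B', ?_, rfl⟩
  have h2 : (B'.card : ℝ) * (2:ℝ) ^ (-(L:ℝ)) ≤ 1 := by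
    rw [← prod_sum_one p hsum m, ← nsmul_eq_mul, ← Finset.sum_const]
    refine le_trans (Finset.sum_le_sum (g := fun x => ∏ i, p (x i)) fun x hx => ?_)
      (Finset.sum_le_sum_of_subset_of_nonneg (Finset.subset_univ _)
        fun x _ _ => Finset.prod_nonneg fun i _ => hp _)
    simp only [hB', hB, Finset.mem_filter, Finset.mem_univ, true_and] at hx
    rw [prod_eq_rpow p hp x hx.2]
    exact Real.rpow_le_rpow_of_exponent_le (by norm_num) (by linarith [hx.1])
  rw [Real.rpow_neg (by norm_num), Real.rpow_natCast, ← div_eq_mul_inv,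
    div_le_one (by positivity)] at h2
  exact_mod_cast h2

lemma sumLargest_le {α : Type*} [Fintype α] (p : α → ℝ) (hp : ∀ a, 0 ≤ p a)
    (m L : ℕ) (d : ℝ) :
    sumLargest p m L ≤ infoCDF p m (L + d) + (2:ℝ) ^ (-d) := by
  classical
  refine csSup_le ⟨0, ∅, by simp⟩ ?_
  rintro y ⟨A, hA, rfl⟩
  rw [← Finset.sum_filter_add_sum_filter_not A
    (fun x => ∑ i, -(Real.logb 2 (p (x i))) ≤ L + d)]
  gcongr
  · unfold infoCDF
    exact Finset.sum_le_sum_of_subset_of_nonneg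
      (Finset.filter_subset_filter _ (Finset.subset_univ _))
      fun x _ _ => Finset.prod_nonneg fun i _ => hp _
  · have : ∀ x ∈ A.filter (fun x => ¬ ∑ i, -(Real.logb 2 (p (x i))) ≤ L + d),
        ∏ i, p (x i) ≤ (2:ℝ) ^ (-(L + d)) := by
      intro x hx
      by_cases h0 : ∏ i, p (x i) = 0
      · rw [h0]; positivity
      · rw [prod_eq_rpow p hp x h0]
        have := (Finset.mem_filter.1 hx).2
        exact Real.rpow_le_rpow_of_exponent_le (by norm_num) (by linarith)
    refine (Finset.sum_le_card_nsmul _ _ _ this).trans ?_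
    rw [nsmul_eq_mul, neg_add, Real.rpow_add (by norm_num), ← mul_assoc]
    refine mul_le_of_le_one_left (by positivity) ?_
    rw [Real.rpow_neg (by norm_num), Real.rpow_natCast, ← div_eq_mul_inv,
      div_le_one (by positivity)]
    calc _ ≤ (A.card : ℝ) := by exact_mod_cast Finset.card_filter_le _ _
      _ ≤ _ := by exact_mod_cast hA

open ProbabilityTheory Topology in
lemma infoCDF_clt {α : Type*} [Fintype α] (p : α → ℝ)
    (hp : ∀ a, 0 ≤ p a) (hsum : ∑ a, p a = 1)
    (H V : ℝ)
    (hH : H = -∑ a, p a * Real.logb 2 (p a))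
    (hV : V = ∑ a, p a * (-(Real.logb 2 (p a)) - H) ^ 2)
    (hVpos : 0 < V) (t : ℝ) :
    Tendsto (fun m : ℕ => infoCDF p m (m * H + t * (√V * √m))) atTop
      (𝓝 (stdGaussianCDF t)) := by
  classical
  let _ : MeasurableSpace α := ⊤
  have : MeasurableSingletonClass α := ⟨fun _ => trivial⟩
  let q : PMF α := PMF.ofFintype (fun a => ENNReal.ofReal (p a)) (by
    rw [← ENNReal.ofReal_sum_of_nonneg (fun a _ => hp a), hsum, ENNReal.ofReal_one])
  have hq : ∀ a, (q a).toReal = p a := fun a => ENNReal.toReal_ofReal (hp a)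
  set μ : Measure α := q.toMeasure with hμ
  set P : Measure (ℕ → α) := Measure.infinitePi (fun _ : ℕ => μ) with hP
  set Z : α → ℝ := fun a => (-(Real.logb 2 (p a)) - H) / √V with hZ
  have mZ : Measurable Z := fun _ _ => trivial
  set X : ℕ → (ℕ → α) → ℝ := fun i ω => Z (ω i) with hX
  have hsV : √V ≠ 0 := (Real.sqrt_pos.2 hVpos).ne'
  have hint : ∀ g : ℝ → ℝ, Measurable g → ∫ ω, g (X 0 ω) ∂P = ∑ a, p a * g (Z a) := by
    intro g hg
    have h1 := (measurePreserving_eval_infinitePi (fun _ : ℕ => μ) 0)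
    have h2 : ∫ ω, g (Z (Function.eval 0 ω)) ∂P = ∫ a, g (Z a) ∂μ := by
      rw [← h1.map_eq, integral_map h1.measurable.aemeasurable]
      exact (hg.comp mZ).aestronglyMeasurable
    have h3 : ∫ a, g (Z a) ∂μ = ∑ a, p a * g (Z a) := by
      rw [hμ, PMF.integral_eq_sum]
      simp [hq]
    rw [← h3, ← h2]
  have h0 : P[X 0] = 0 := by
    have := hint id measurable_id
    simp only [id] at this
    rw [this]
    simp only [hZ, mul_div_assoc']
    rw [← Finset.sum_div]
    simp only [mul_sub, Finset.sum_sub_distrib, ← Finset.sum_mul, hsum, mul_neg,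
      Finset.sum_neg_distrib]
    rw [hH]; simp
  have h1 : P[X 0 ^ 2] = 1 := by
    have := hint (fun x => x ^ 2) (by fun_prop)
    simp only [Pi.pow_apply]
    rw [this]
    simp only [hZ, div_pow, Real.sq_sqrt hVpos.le, mul_div_assoc']
    rw [← Finset.sum_div, ← hV, div_self hVpos.ne']
  have hindep : iIndepFun X P := iIndepFun_infinitePi (fun _ => mZ)
  have hident : ∀ i, IdentDistrib (X i) (X 0) P P := by
    intro i
    have e : ∀ i, P.map (X i) = μ.map Z := by
      intro i
      rw [← Measure.infinitePi_map_eval (fun _ : ℕ => μ) i, Measure.map_map mZ (by fun_prop)]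
      rfl
    exact ⟨(mZ.comp (measurable_pi_apply i)).aemeasurable,
      (mZ.comp (measurable_pi_apply 0)).aemeasurable, by rw [e, e]⟩
  have hY : HasLaw (id : ℝ → ℝ) (gaussianReal 0 1) (gaussianReal 0 1) := HasLaw.id
  have clt := tendstoInDistribution_inv_sqrt_mul_sum hY h0 h1 hindep hident
  have : NullSingletonClass (gaussianReal 0 1) := nullSingletonClass_gaussianReal one_ne_zero
  have key := ProbabilityMeasure.tendsto_measure_of_null_frontier_of_tendsto' clt.tendsto
    (E := Set.Iic t) (by simp)
  have key2 := (ENNReal.tendsto_toReal (by simp [measure_ne_top])).comp key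
  simp only [ProbabilityMeasure.coe_mk, Measure.map_id] at key2
  rw [← measureReal_def, ← stdGaussianCDF_eq] at key2
  refine key2.congr' ?_
  filter_upwards [eventually_gt_atTop 0] with m hm
  have hm' : 0 < √(m:ℝ) := Real.sqrt_pos.2 (by exact_mod_cast hm)
  have mr : Measurable (fun (ω : ℕ → α) (i : Fin m) => ω i) := by fun_prop
  have hmap : P.map (fun (ω : ℕ → α) (i : Fin m) => ω i) = Measure.pi (fun _ : Fin m => μ) := by
    rw [hP, Measure.map_infinitePi_infinitePi_of_inj (f := fun i : Fin m => (i : ℕ))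
      Fin.val_injective, Measure.infinitePi_eq_pi]
  simp only [Function.comp_apply]
  rw [Measure.map_apply_of_aemeasurable (clt.forall_aemeasurable m) measurableSet_Iic]
  set B : Finset (Fin m → α) :=
    {x | ∑ i, -(Real.logb 2 (p (x i))) ≤ m * H + t * (√V * √m)} with hB
  have hpre : (fun ω => (√(m:ℝ))⁻¹ * ∑ k ∈ Finset.range m, X k ω) ⁻¹' Set.Iic t =
      (fun (ω : ℕ → α) (i : Fin m) => ω i) ⁻¹' (B : Set (Fin m → α)) := by
    ext ω
    simp only [Set.mem_preimage, Set.mem_Iic, hB, Finset.coe_filter, Finset.mem_univ, true_and,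
      Set.mem_ofPred_eq, hX, hZ]
    rw [← Finset.sum_div, Finset.sum_sub_distrib, inv_mul_le_iff₀ hm',
      div_le_iff₀ (Real.sqrt_pos.2 hVpos),
      Fin.sum_univ_eq_sum_range (fun i => -(Real.logb 2 (p (ω i)))) m]
    simp only [Finset.sum_const, Finset.card_range, nsmul_eq_mul]
    rw [sub_le_iff_le_add]
    have : √(m:ℝ) * t * √V + m * H = m * H + t * (√V * √m) := by ring
    rw [this]
  rw [hpre, ← Measure.map_apply mr (Finset.measurableSet B), hmap, ← measureReal_def,
    ← sum_measureReal_singleton]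
  unfold infoCDF
  refine Finset.sum_congr rfl fun x _ => ?_
  rw [measureReal_def, Measure.pi_singleton, ENNReal.toReal_prod]
  refine Finset.prod_congr rfl fun i _ => ?_
  rw [hμ, PMF.toMeasure_apply_singleton _ _ (MeasurableSet.singleton _), hq]

open Topology in
lemma infoCDF_clt' {α : Type*} [Fintype α] (p : α → ℝ)
    (hp : ∀ a, 0 ≤ p a) (hsum : ∑ a, p a = 1)
    (H V : ℝ)
    (hH : H = -∑ a, p a * Real.logb 2 (p a))
    (hV : V = ∑ a, p a * (-(Real.logb 2 (p a)) - H) ^ 2)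
    (hVpos : 0 < V) (c : ℝ) (m : ℕ → ℕ) (s : ℕ → ℝ) (hm : Tendsto m atTop atTop)
    (hs : Tendsto (fun n => (s n - m n * H) / √(m n)) atTop (𝓝 c)) :
    Tendsto (fun n : ℕ => infoCDF p (m n) (s n)) atTop
      (𝓝 (stdGaussianCDF (c / √V))) := by
  have hsV : 0 < √V := Real.sqrt_pos.2 hVpos
  have C := fun t => (infoCDF_clt p hp hsum H V hH hV hVpos t).comp hm
  have hs' := hs.div_const (√V)
  have cont := stdGaussianCDF_cont.tendsto (c / √V)
  refine tendsto_order.2 ⟨fun a ha => ?_, fun a ha => ?_⟩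
  · obtain ⟨u, hu, hua⟩ : ∃ u < c / √V, a < stdGaussianCDF u := by
      have := (cont.mono_left (nhdsWithin_le_nhds (s := Set.Iio (c / √V)))).eventually (lt_mem_nhds ha)
      obtain ⟨u, h1, h2⟩ := (this.and self_mem_nhdsWithin).exists
      exact ⟨u, h2, h1⟩
    filter_upwards [(C u).eventually (lt_mem_nhds hua), hs'.eventually (lt_mem_nhds hu),
      hm.eventually (eventually_gt_atTop 0)] with n h1 h2 h3
    refine lt_of_lt_of_le h1 (infoCDF_mono p hp _ ?_)
    have h3' : 0 < √(m n : ℝ) := Real.sqrt_pos.2 (by exact_mod_cast h3)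
    rw [lt_div_iff₀ hsV, lt_div_iff₀ h3'] at h2
    linarith
  · obtain ⟨u, hu, hua⟩ : ∃ u > c / √V, stdGaussianCDF u < a := by
      have := (cont.mono_left (nhdsWithin_le_nhds (s := Set.Ioi (c / √V)))).eventually (gt_mem_nhds ha)
      obtain ⟨u, h1, h2⟩ := (this.and self_mem_nhdsWithin).exists
      exact ⟨u, h2, h1⟩
    filter_upwards [(C u).eventually (gt_mem_nhds hua), hs'.eventually (gt_mem_nhds hu),
      hm.eventually (eventually_gt_atTop 0)] with n h1 h2 h3
    refine lt_of_le_of_lt (infoCDF_mono p hp _ ?_) h1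
    have h3' : 0 < √(m n : ℝ) := Real.sqrt_pos.2 (by exact_mod_cast h3)
    rw [div_lt_iff₀ hsV, div_lt_iff₀ h3'] at h2
    linarith

open Topology in
lemma floor_div_tendsto (f g : ℕ → ℝ) (l : ℝ) (hg : Tendsto g atTop atTop)
    (h : Tendsto (fun n => f n / g n) atTop (𝓝 l)) :
    Tendsto (fun n => (⌊f n⌋ : ℝ) / g n) atTop (𝓝 l) := by
  have h1 : Tendsto (fun n => f n / g n - 1 / g n) atTop (𝓝 l) := by
    simpa using h.sub ((tendsto_const_nhds (x := (1:ℝ))).div_atTop hg)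
  refine tendsto_of_tendsto_of_tendsto_of_le_of_le' h1 h ?_ ?_
  · filter_upwards [hg.eventually (eventually_gt_atTop 0)] with n hn
    rw [← sub_div]
    exact div_le_div_of_nonneg_right (Int.sub_one_lt_floor _).le hn.le
  · filter_upwards [hg.eventually (eventually_gt_atTop 0)] with n hn
    exact div_le_div_of_nonneg_right (Int.floor_le _) hn.le

open Topology in
/-- For `L_n = ⌊Hn + b√n⌋` and `m_n = n + ⌊b'√n⌋`, the sum of the `2^{L_n}` largest
probabilities of `p^{⊗ m_n}` converges to `G((b − H b')/√V)`. -/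
theorem stmt_16 {α : Type*} [Fintype α] (p : α → ℝ)
    (hp : ∀ a, 0 ≤ p a) (hsum : ∑ a, p a = 1)
    (H V : ℝ)
    (hH : H = -∑ a, p a * Real.logb 2 (p a))
    (hV : V = ∑ a, p a * (-(Real.logb 2 (p a)) - H) ^ 2)
    (hHpos : 0 < H) (hVpos : 0 < V) (b b' : ℝ) :
    Filter.Tendsto (fun n : ℕ =>
        sumLargest p ((n : ℤ) + ⌊b' * Real.sqrt n⌋).toNat
          (⌊H * n + b * Real.sqrt n⌋.toNat))
      Filter.atTop (nhds (stdGaussianCDF ((b - H * b') / Real.sqrt V))) := by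
  set r : ℕ → ℝ := fun n => √(n:ℝ) with hr
  have hrT : Tendsto r atTop atTop := Real.tendsto_sqrt_atTop.comp tendsto_natCast_atTop_atTop
  have hrr : ∀ n : ℕ, (n:ℝ) = r n * r n := fun n => (Real.mul_self_sqrt n.cast_nonneg).symm
  have hrpos : ∀ᶠ n in atTop, 0 < r n := hrT.eventually (eventually_gt_atTop 0)
  have hrinv : Tendsto (fun n => 1 / r n) atTop (𝓝 0) := tendsto_const_nhds.div_atTop hrT
  set m : ℕ → ℕ := fun n => ((n : ℤ) + ⌊b' * Real.sqrt n⌋).toNat with hm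
  set L : ℕ → ℕ := fun n => ⌊H * n + b * Real.sqrt n⌋.toNat with hL
  -- floors
  have f1 : Tendsto (fun n => (⌊b' * r n⌋ : ℝ) / r n) atTop (𝓝 b') := by
    refine floor_div_tendsto _ _ _ hrT (tendsto_const_nhds.congr' ?_)
    filter_upwards [hrpos] with n hn
    field_simp
  have e0 : ∀ᶠ n in atTop, -(|b'| + 1) ≤ (⌊b' * r n⌋ : ℝ) / r n := by
    refine f1.eventually (le_mem_nhds ?_)
    linarith [neg_abs_le b']
  have hmn : ∀ᶠ n : ℕ in atTop, (m n : ℝ) = n + ⌊b' * r n⌋ := by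
    filter_upwards [hrpos, e0, hrT.eventually (eventually_ge_atTop (|b'| + 1))] with n h1 h2 h3
    rw [le_div_iff₀ h1] at h2
    have : (0:ℝ) ≤ (n:ℝ) + ⌊b' * r n⌋ := by rw [hrr n]; nlinarith
    have h' : (0:ℤ) ≤ (n:ℤ) + ⌊b' * √(n:ℝ)⌋ := by exact_mod_cast this
    have := Int.toNat_of_nonneg h'
    have h4 : ((m n : ℤ) : ℝ) = (((n:ℤ) + ⌊b' * √(n:ℝ)⌋ : ℤ) : ℝ) := by rw [← this]
    push_cast at h4
    exact h4
  have hLn : ∀ᶠ n : ℕ in atTop, (L n : ℝ) = ⌊H * n + b * r n⌋ := by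
    filter_upwards [hrpos, hrT.eventually (eventually_ge_atTop (|b| / H))] with n h1 h3
    rw [div_le_iff₀ hHpos] at h3
    have : (0:ℝ) ≤ H * n + b * r n := by
      rw [hrr n]; nlinarith [neg_abs_le b]
    have := Int.toNat_of_nonneg (Int.floor_nonneg.2 this)
    exact_mod_cast this
  -- ratio m / n
  have g1 : Tendsto (fun n => (m n : ℝ) / (n:ℝ)) atTop (𝓝 1) := by
    have : Tendsto (fun n => 1 + (⌊b' * r n⌋ : ℝ) / r n * (1 / r n)) atTop (𝓝 1) := by
      simpa using (tendsto_const_nhds (x := (1:ℝ))).add (f1.mul hrinv)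
    refine this.congr' ?_
    filter_upwards [hmn, hrpos] with n h1 h2
    rw [h1, hrr n]
    field_simp
  have hmT : Tendsto m atTop atTop := by
    have : Tendsto (fun n : ℕ => (m n : ℝ)) atTop atTop := by
      refine (Tendsto.pos_mul_atTop one_pos g1 tendsto_natCast_atTop_atTop).congr' ?_
      filter_upwards [eventually_gt_atTop 0] with n hn
      have : (n:ℝ) ≠ 0 := by exact_mod_cast hn.ne'
      field_simp
    exact tendsto_natCast_atTop_iff.1 this
  have g2 : Tendsto (fun n => √(m n : ℝ) / r n) atTop (𝓝 1) := by
    have := (Real.continuous_sqrt.tendsto 1).comp g1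
    rw [Real.sqrt_one] at this
    refine this.congr fun n => ?_
    simp [hr, Real.sqrt_div]
  have f2 : Tendsto (fun n : ℕ => ((L n : ℝ) - m n * H) / r n) atTop (𝓝 (b - H * b')) := by
    have f3 : Tendsto (fun n : ℕ => (⌊H * n + b * r n - H * n⌋ : ℝ) / r n) atTop (𝓝 b) := by
      refine floor_div_tendsto _ _ _ hrT (tendsto_const_nhds.congr' ?_)
      filter_upwards [hrpos] with n hn
      field_simp; ring
    have f4 : Tendsto (fun n : ℕ => ((⌊H * n + b * r n⌋ : ℝ) - H * n) / r n) atTop (𝓝 b) := by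
      have h1 : Tendsto (fun n => b - 1 / r n) atTop (𝓝 b) := by
        simpa using (tendsto_const_nhds (x := b)).sub hrinv
      refine tendsto_of_tendsto_of_tendsto_of_le_of_le' h1 (tendsto_const_nhds (x := b)) ?_ ?_
      · filter_upwards [hrpos] with n hn
        rw [le_div_iff₀ hn, sub_mul, one_div_mul_cancel hn.ne']
        linarith [Int.sub_one_lt_floor (H * n + b * r n)]
      · filter_upwards [hrpos] with n hn
        rw [div_le_iff₀ hn]
        linarith [Int.floor_le (H * n + b * r n)]
    refine (f4.sub (f1.const_mul H)).congr' ?_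
    filter_upwards [hrpos, hmn, hLn] with n h1 h2 h3
    rw [h2, h3]
    field_simp
    ring
  -- general second-order shift
  have sh : ∀ d : ℕ → ℝ, Tendsto (fun n => d n / r n) atTop (𝓝 0) →
      Tendsto (fun n => infoCDF p (m n) (L n + d n)) atTop
        (𝓝 (stdGaussianCDF ((b - H * b') / √V))) := by
    intro d hd
    refine infoCDF_clt' p hp hsum H V hH hV hVpos _ m _ hmT ?_
    have := (f2.add hd).div g2 one_ne_zero
    rw [add_zero, div_one] at this
    refine this.congr' ?_
    filter_upwards [hrpos, hmT.eventually (eventually_gt_atTop 0)] with n h1 h2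
    have h3' : 0 < √(m n : ℝ) := Real.sqrt_pos.2 (by exact_mod_cast h2)
    simp only [Pi.div_apply]
    field_simp
    ring
  have lo := sh (fun _ => 0) (by simp)
  have hsr : Tendsto (fun n => √(r n)) atTop atTop := Real.tendsto_sqrt_atTop.comp hrT
  have hi := sh (fun n => √(r n)) (by
    refine ((tendsto_const_nhds (x := (1:ℝ))).div_atTop hsr).congr' ?_
    filter_upwards [hrpos] with n hn
    rw [Real.sqrt_div_self'])
  have hz : Tendsto (fun n => (2:ℝ) ^ (-√(r n))) atTop (𝓝 0) :=
    (tendsto_rpow_atBot_of_base_gt_one 2 (by norm_num)).comp (tendsto_neg_atTop_atBot.comp hsr)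
  have hi' := hi.add hz
  rw [add_zero] at hi'
  refine tendsto_of_tendsto_of_tendsto_of_le_of_le lo hi' (fun n => ?_) (fun n => ?_)
  · simpa using le_sumLargest p hp hsum (m n) (L n)
  · exact sumLargest_le p hp (m n) (L n) _
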